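/- arXiv:math/0310491 — 6 statements merged into one kernel-verified Lean document; each statement's English description precedes it below -/
import Mathlib

section
/- Let A, B, D be C*-algebras, A₀ ⊆ A and B₀ ⊆ B closed *-subalgebras, and χ : B → D a *-homomorphism. Let π = (π_t)_{t∈[1,∞)} : A → B be an asymptotic homomorphism and μ : A → D a *-homomorphism such that χ(π_t(a)) = μ(a) for all t ∈ [1,∞) and all a ∈ A, and assume π_t(A₀) ⊆ B₀ for all t ∈ [1,∞). Then there exists an equi-continuous asymptotic homomorphism π̂ = (π̂_t)_{t∈[1,∞)} : A → B such that (1) lim_{t→∞} ‖π_t(a) − π̂_t(a)‖ = 0 for all a ∈ A, (2) χ(π̂_t(a)) = μ(a) for all t ∈ [1,∞) and a ∈ A, and (3) π̂_t(A₀) ⊆ B₀ for all t ∈ [1,∞). -/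
open Filter Topology

/-- `φ = (φ_t)_{t ∈ [1,∞)} : A → B` is an asymptotic homomorphism: each `t ↦ φ t a` is
norm-continuous on `[1,∞)` and the algebraic operations are respected asymptotically. -/
def IsAsymptoticHom {A B : Type*} [Mul A] [Add A] [SMul ℂ A] [Star A]
    [SeminormedAddCommGroup B] [Mul B] [SMul ℂ B] [Star B] (φ : ℝ → A → B) : Prop :=
  (∀ a : A, ContinuousOn (fun t => φ t a) (Set.Ici 1)) ∧
  (∀ a b : A, Tendsto (fun t => ‖φ t a * φ t b - φ t (a * b)‖) atTop (𝓝 0)) ∧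
  (∀ (a b : A) (c : ℂ), Tendsto (fun t => ‖φ t a + c • φ t b - φ t (a + c • b)‖) atTop (𝓝 0)) ∧
  (∀ a : A, Tendsto (fun t => ‖star (φ t a) - φ t (star a)‖) atTop (𝓝 0))

open Set BoundedContinuousFunction

section Selection

variable {X E : Type*} [TopologicalSpace X] [NormalSpace X] [ParacompactSpace X]
  [NormedAddCommGroup E] [NormedSpace ℝ E] {F : X → Set E}

/-- Continuous approximate selections of a lower semicontinuous convex-valued map, constrained to
lie in a further convex-valued map `V`. -/
lemma exists_continuous_mem_thickening_inter (hconv : ∀ x, Convex ℝ (F x))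
    (hlsc : ∀ x, ∀ y ∈ F x, ∀ ε > 0, ∀ᶠ x' in 𝓝 x, ∃ y' ∈ F x', dist y y' < ε)
    {V : X → Set E} (hVconv : ∀ x, Convex ℝ (V x))
    (hV : ∀ x, ∃ y ∈ F x, ∀ᶠ x' in 𝓝 x, y ∈ V x') {δ : ℝ} (hδ : 0 < δ) :
    ∃ g : C(X, E), ∀ x, g x ∈ Metric.thickening δ (F x) ∩ V x := by
  refine exists_continuous_forall_mem_convex_of_local_const
    (fun x => ((hconv x).thickening δ).inter (hVconv x)) fun x => ?_
  obtain ⟨y, hy, hyV⟩ := hV x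
  refine ⟨y, ?_⟩
  filter_upwards [hyV, hlsc x y hy δ hδ] with x' h₁ h₂
  exact ⟨Metric.mem_thickening_iff.2 h₂, h₁⟩

/-- **Michael's selection theorem**: a lower semicontinuous map from a paracompact normal space to
the nonempty closed convex subsets of a Banach space has a continuous selection. -/
theorem exists_continuous_selection [CompleteSpace E]
    (hne : ∀ x, (F x).Nonempty) (hclosed : ∀ x, IsClosed (F x)) (hconv : ∀ x, Convex ℝ (F x))
    (hlsc : ∀ x, ∀ y ∈ F x, ∀ ε > 0, ∀ᶠ x' in 𝓝 x, ∃ y' ∈ F x', dist y y' < ε) :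
    ∃ g : C(X, E), ∀ x, g x ∈ F x := by
  have hpos : ∀ n : ℕ, (0 : ℝ) < (1 / 2) ^ n := fun n => by positivity
  obtain ⟨g₀, hg₀⟩ := exists_continuous_mem_thickening_inter hconv hlsc
    (V := fun _ => univ) (fun _ => convex_univ)
    (fun x => (hne x).imp fun y hy => ⟨hy, Eventually.of_forall fun _ => mem_univ _⟩) (hpos 0)
  have step : ∀ (n : ℕ) (g : C(X, E)), (∀ x, g x ∈ Metric.thickening ((1 / 2) ^ n) (F x)) →
      ∃ g' : C(X, E), (∀ x, g' x ∈ Metric.thickening ((1 / 2) ^ (n + 1)) (F x)) ∧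
        ∀ x, dist (g x) (g' x) ≤ 1 * (1 / 2) ^ n := by
    intro n g hg
    obtain ⟨g', hg'⟩ := exists_continuous_mem_thickening_inter hconv hlsc
      (V := fun x => Metric.ball (g x) ((1 / 2) ^ n)) (fun x => convex_ball _ _) (fun x => by
        obtain ⟨y, hy, hxy⟩ := Metric.mem_thickening_iff.1 (hg x)
        refine ⟨y, hy, ?_⟩
        have hcont : Tendsto (fun x' => dist y (g x')) (𝓝 x) (𝓝 (dist y (g x))) :=
          (continuous_const.dist g.continuous).tendsto x
        exact hcont.eventually_lt_const (by rwa [dist_comm])) (hpos (n + 1))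
    refine ⟨g', fun x => (hg' x).1, fun x => ?_⟩
    rw [one_mul, dist_comm]
    exact (Metric.mem_ball.1 (hg' x).2).le
  choose! next hnext hdist using step
  let g : ℕ → C(X, E) := fun n => Nat.rec g₀ next n
  have hg : ∀ n x, g n x ∈ Metric.thickening ((1 / 2) ^ n) (F x) := by
    intro n
    induction n with
    | zero => exact fun x => (hg₀ x).1
    | succ n ih => exact hnext n _ ih
  have hgdist : ∀ x n, dist (g n x) (g (n + 1) x) ≤ 1 * (1 / 2) ^ n :=
    fun x n => hdist n _ (hg n) x
  have hlim : ∀ x, ∃ y, Tendsto (fun n => g n x) atTop (𝓝 y) := fun x =>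
    cauchySeq_tendsto_of_complete
      (cauchySeq_of_le_geometric _ _ one_half_lt_one (hgdist x))
  choose G hG using hlim
  have hbound : ∀ n x, dist (g n x) (G x) ≤ 1 * (1 / 2) ^ n / (1 - 1 / 2) := fun n x =>
    dist_le_of_le_geometric_of_tendsto _ _ one_half_lt_one (hgdist x) (hG x) n
  have hpow : Tendsto (fun n : ℕ => ((1 : ℝ) / 2) ^ n) atTop (𝓝 0) :=
    tendsto_pow_atTop_nhds_zero_of_lt_one (by norm_num) (by norm_num)
  have hunif : TendstoUniformly (fun n x => g n x) G atTop := by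
    rw [Metric.tendstoUniformly_iff]
    intro ε hε
    have h : Tendsto (fun n : ℕ => 1 * ((1 : ℝ) / 2) ^ n / (1 - 1 / 2)) atTop (𝓝 0) := by
      simpa using (hpow.const_mul 1).div_const (1 - 1 / 2)
    filter_upwards [h.eventually_lt_const hε] with n hn x
    rw [dist_comm]
    exact (hbound n x).trans_lt hn
  refine ⟨⟨G, hunif.continuous (Frequently.of_forall fun n => (g n).continuous)⟩, fun x => ?_⟩
  choose y hyF hy using fun n => Metric.mem_thickening_iff.1 (hg n x)
  refine (hclosed x).mem_of_tendsto (f := y) (b := atTop) ?_ (Eventually.of_forall hyF)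
  refine (hG x).congr_dist ?_
  exact squeeze_zero (fun _ => dist_nonneg) (fun n => (hy n).le) hpow

end Selection

/-- A closed linear relation between Banach spaces whose domain is a closed subspace `S` admits
norm-controlled choices. -/
lemma exists_norm_le_of_isClosed_submodule_prod {𝕜 V W : Type*} [NontriviallyNormedField 𝕜]
    [NormedAddCommGroup V] [NormedSpace 𝕜 V] [CompleteSpace V]
    [NormedAddCommGroup W] [NormedSpace 𝕜 W] [CompleteSpace W]
    (P : Submodule 𝕜 (V × W)) (hP : IsClosed (P : Set (V × W)))
    (S : Submodule 𝕜 V) (hS : IsClosed (S : Set V))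
    (hPS : ∀ p ∈ P, p.1 ∈ S) (hsurj : ∀ v ∈ S, ∃ w, (v, w) ∈ P) :
    ∃ C > 0, ∀ v ∈ S, ∃ w, (v, w) ∈ P ∧ ‖w‖ ≤ C * ‖v‖ := by
  have : CompleteSpace P := hP.completeSpace_coe
  have : CompleteSpace S := hS.completeSpace_coe
  let T : P →L[𝕜] S :=
    ((ContinuousLinearMap.fst 𝕜 V W).comp P.subtypeL).codRestrict S fun p => hPS p p.2
  have hT : Function.Surjective T := fun v => by
    obtain ⟨w, hw⟩ := hsurj v v.2
    exact ⟨⟨_, hw⟩, rfl⟩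
  obtain ⟨C, hC, h⟩ := T.exists_preimage_norm_le hT
  refine ⟨C, hC, fun v hv => ?_⟩
  obtain ⟨p, hp, hpn⟩ := h ⟨v, hv⟩
  have hp1 : p.1.1 = v := congrArg Subtype.val hp
  refine ⟨p.1.2, ?_, (norm_snd_le p.1).trans hpn⟩
  rw [← hp1]
  exact p.2

/-- A contraction `a` satisfies `a⋆a + b² = 2b` for a self-adjoint `b`, namely
`b = 1 - √(1 - a⋆a)`. -/
lemma exists_isSelfAdjoint_star_mul_self_add_mul_self {A : Type*} [NonUnitalCStarAlgebra A]
    (a : A) (ha : ‖a‖ ≤ 1) :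
    ∃ b : A, IsSelfAdjoint b ∧ star a * a + b * b = b + b := by
  have hsa : IsSelfAdjoint (star a * a) := .star_mul_self a
  let f : ℝ → ℝ := fun x => 1 - √(1 - x)
  have hf : Continuous f := by fun_prop
  have hf0 : f 0 = 0 := by simp [f]
  refine ⟨cfcₙ f (star a * a), cfcₙ_predicate f _, ?_⟩
  nth_rewrite 1 [← cfcₙ_id' ℝ (star a * a) hsa]
  rw [← cfcₙ_mul f f _ hf.continuousOn hf0 hf.continuousOn hf0,
    ← cfcₙ_add (fun x => x) (fun x => f x * f x) _ continuousOn_id rfl (hf.mul hf).continuousOn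
      (by simp [hf0]),
    ← cfcₙ_add _ _ _ hf.continuousOn hf0 hf.continuousOn hf0]
  refine cfcₙ_congr fun x hx => ?_
  have hx1 : x ≤ 1 := by
    refine (le_abs_self x).trans
      ((NonUnitalIsometricContinuousFunctionalCalculus.norm_quasispectrum_le _ hx hsa).trans ?_)
    rw [CStarRing.norm_star_mul_self]
    nlinarith [norm_nonneg a]
  have := Real.sq_sqrt (sub_nonneg.2 hx1)
  simp only [f]
  nlinarith

lemma norm_le_of_norm_star_mul_self_add_sub_le {B : Type*} [NonUnitalCStarAlgebra B] {x y : B}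
    {e : ℝ} (he : 0 ≤ e) (h : ‖star x * x + star y * y - y - star y‖ ≤ e) :
    ‖x‖ ≤ 1 + e ∧ ‖y‖ ≤ 2 + e := by
  let _ := CStarAlgebra.spectralOrder (Unitization ℂ B)
  have _ := CStarAlgebra.spectralOrderedRing (Unitization ℂ B)
  let X : Unitization ℂ B := x
  let Y : Unitization ℂ B := 1 - (y : Unitization ℂ B)
  have hsum : star X * X + star Y * Y
      = 1 + ((star x * x + star y * y - y - star y : B) : Unitization ℂ B) := by
    simp only [X, Y, Unitization.inr_add, Unitization.inr_sub, Unitization.inr_mul,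
      Unitization.inr_star, star_sub, star_one]
    noncomm_ring
  have hnorm : ‖star X * X + star Y * Y‖ ≤ 1 + e := by
    rw [hsum]
    refine (norm_add_le _ _).trans (add_le_add CStarRing.norm_one.le ?_)
    rwa [Unitization.norm_inr]
  have key : ∀ {Z W : Unitization ℂ B}, ‖star Z * Z + star W * W‖ ≤ 1 + e → ‖Z‖ ≤ 1 + e := by
    intro Z W hZW
    have h₁ : ‖star Z * Z‖ ≤ ‖star Z * Z + star W * W‖ :=
      CStarAlgebra.norm_le_norm_of_nonneg_of_le (star_mul_self_nonneg Z)
        (le_add_of_nonneg_right (star_mul_self_nonneg W))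
    rw [CStarRing.norm_star_mul_self] at h₁
    nlinarith [norm_nonneg Z]
  refine ⟨?_, ?_⟩
  · have := key hnorm
    rwa [Unitization.norm_inr] at this
  · have hY := key (Z := Y) (W := X) (by rwa [add_comm])
    have hy : ‖(y : Unitization ℂ B)‖ ≤ ‖(1 : Unitization ℂ B)‖ + ‖Y‖ := by
      simpa [Y] using norm_sub_le (1 : Unitization ℂ B) Y
    rw [Unitization.norm_inr, CStarRing.norm_one] at hy
    linarith

namespace IsAsymptoticHom

variable {A B D : Type*} [NonUnitalCStarAlgebra A] [NonUnitalCStarAlgebra B]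
  [NonUnitalCStarAlgebra D] {π : ℝ → A → B}

lemma tendsto_mul (hπ : IsAsymptoticHom π) (a b : A) :
    Tendsto (fun t => π t a * π t b - π t (a * b)) atTop (𝓝 0) :=
  tendsto_zero_iff_norm_tendsto_zero.2 (hπ.2.1 a b)

lemma tendsto_add_smul (hπ : IsAsymptoticHom π) (a b : A) (c : ℂ) :
    Tendsto (fun t => π t a + c • π t b - π t (a + c • b)) atTop (𝓝 0) :=
  tendsto_zero_iff_norm_tendsto_zero.2 (hπ.2.2.1 a b c)

lemma tendsto_add (hπ : IsAsymptoticHom π) (a b : A) :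
    Tendsto (fun t => π t a + π t b - π t (a + b)) atTop (𝓝 0) := by
  simpa using hπ.tendsto_add_smul a b 1

lemma tendsto_star (hπ : IsAsymptoticHom π) (a : A) :
    Tendsto (fun t => star (π t a) - π t (star a)) atTop (𝓝 0) :=
  tendsto_zero_iff_norm_tendsto_zero.2 (hπ.2.2.2 a)

lemma tendsto_zero (hπ : IsAsymptoticHom π) : Tendsto (fun t => π t 0) atTop (𝓝 0) := by
  simpa using hπ.tendsto_add 0 0

lemma tendsto_smul (hπ : IsAsymptoticHom π) (c : ℂ) (a : A) :
    Tendsto (fun t => c • π t a - π t (c • a)) atTop (𝓝 0) := by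
  have h := (hπ.tendsto_add_smul 0 a c).sub hπ.tendsto_zero
  rw [sub_zero] at h
  refine h.congr fun t => ?_
  rw [zero_add]
  abel

lemma eventually_norm_le_two (hπ : IsAsymptoticHom π) {a : A} (ha : ‖a‖ ≤ 1) :
    ∀ᶠ t in atTop, ‖π t a‖ ≤ 2 := by
  obtain ⟨b, hb, hab⟩ := exists_isSelfAdjoint_star_mul_self_add_mul_self a ha
  have hη : (0 : ℝ) < 1 / 40 := by norm_num
  have small : ∀ {u : ℝ → B}, Tendsto u atTop (𝓝 0) → ∀ᶠ t in atTop, ‖u t‖ < 1 / 40 :=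
    fun h => (tendsto_zero_iff_norm_tendsto_zero.1 h).eventually_lt_const hη
  have hstar := hπ.tendsto_star b
  rw [hb.star_eq] at hstar
  filter_upwards [small (hπ.tendsto_star a), small (hπ.tendsto_mul (star a) a), small hstar,
    small (hπ.tendsto_mul b b), small (hπ.tendsto_add (star a * a) (b * b)),
    small (hπ.tendsto_add b b)] with t h₁ h₂ h₃ h₄ h₅ h₆
  rw [hab] at h₅
  set x := π t a
  set y := π t b
  have hdecomp : star x * x + star y * y - y - star y
      = (star x - π t (star a)) * x + (π t (star a) * x - π t (star a * a))
        + (star y - y) * y + (y * y - π t (b * b))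
        + (π t (star a * a) + π t (b * b) - π t (b + b)) - (y + y - π t (b + b))
        - (star y - y) := by
    noncomm_ring
  have hx := norm_mul_le (star x - π t (star a)) x
  have hy := norm_mul_le (star y - y) y
  have hx' := mul_le_mul_of_nonneg_right h₁.le (norm_nonneg x)
  have hy' := mul_le_mul_of_nonneg_right h₃.le (norm_nonneg y)
  have hbound : ‖star x * x + star y * y - y - star y‖ ≤ 1 / 8 * (1 + ‖x‖ + ‖y‖) := by
    rw [hdecomp]
    refine (norm_sub_le_of_le (norm_sub_le_of_le (norm_add_le_of_le (norm_add_le_of_le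
      (norm_add_le_of_le (norm_add_le_of_le (hx.trans hx') h₂.le) (hy.trans hy')) h₄.le) h₅.le)
      h₆.le) h₃.le).trans ?_
    linarith [norm_nonneg x, norm_nonneg y]
  obtain ⟨h₇, h₈⟩ := norm_le_of_norm_star_mul_self_add_sub_le (by positivity) hbound
  linarith

/-- An asymptotic homomorphism is asymptotically bounded. -/
lemma eventually_norm_le (hπ : IsAsymptoticHom π) {a : A} {r : ℝ} (hr : 0 < r) (ha : ‖a‖ ≤ r) :
    ∀ᶠ t in atTop, ‖π t a‖ ≤ 3 * r := by
  have hr' : (r : ℂ) ≠ 0 := Complex.ofReal_ne_zero.2 hr.ne'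
  have hnorm : ‖(r : ℂ)‖ = r := by simp [hr.le]
  have hscaled : ‖(r : ℂ)⁻¹ • a‖ ≤ 1 := by
    rw [norm_smul, norm_inv, hnorm, inv_mul_le_iff₀ hr, mul_one]
    exact ha
  have h := hπ.tendsto_smul (r : ℂ) ((r : ℂ)⁻¹ • a)
  rw [smul_inv_smul₀ hr'] at h
  filter_upwards [hπ.eventually_norm_le_two hscaled,
    (tendsto_zero_iff_norm_tendsto_zero.1 h).eventually_lt_const hr] with t h₁ h₂
  have h₃ : ‖(r : ℂ) • π t ((r : ℂ)⁻¹ • a)‖ ≤ r * 2 := by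
    rw [norm_smul, hnorm]
    gcongr
  have h₄ := norm_sub_le_of_le h₃ h₂.le
  rw [sub_sub_cancel] at h₄
  linarith

lemma isBoundedUnder_norm (hπ : IsAsymptoticHom π) (a : A) :
    IsBoundedUnder (· ≤ ·) atTop (norm ∘ fun t => π t a) :=
  ⟨_, eventually_map.2 (hπ.eventually_norm_le (a := a) (r := ‖a‖ + 1) (by positivity)
    (by linarith))⟩

/-- A family pointwise asymptotic to an asymptotic homomorphism is an asymptotic homomorphism. -/
lemma of_tendsto_sub (hπ : IsAsymptoticHom π) {ρ : ℝ → A → B}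
    (hcont : ∀ a, ContinuousOn (fun t => ρ t a) (Ici 1))
    (hρ : ∀ a, Tendsto (fun t => π t a - ρ t a) atTop (𝓝 0)) : IsAsymptoticHom ρ := by
  refine ⟨hcont, fun a b => ?_, fun a b c => ?_, fun a => ?_⟩ <;>
    rw [← tendsto_zero_iff_norm_tendsto_zero]
  · have h₁ := isBoundedUnder_le_mul_tendsto_zero (hπ.isBoundedUnder_norm a) (hρ b)
    have h₂ := (hρ a).zero_mul_isBoundedUnder_le (hπ.isBoundedUnder_norm b)
    have h := ((((hπ.tendsto_mul a b).sub h₁).sub h₂).add ((hρ a).mul (hρ b))).add (hρ (a * b))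
    simp only [mul_zero, sub_zero, add_zero] at h
    exact h.congr fun t => by noncomm_ring
  · have h := (((hπ.tendsto_add_smul a b c).sub (hρ a)).sub ((hρ b).const_smul c)).add
      (hρ (a + c • b))
    simp only [smul_zero, sub_zero, add_zero] at h
    refine h.congr fun t => ?_
    rw [smul_sub]
    abel
  · have h := ((hπ.tendsto_star a).sub (hρ a).star).add (hρ (star a))
    simp only [star_zero, sub_zero, add_zero] at h
    refine h.congr fun t => ?_
    rw [star_sub]
    abel

/-- The path `t ↦ π t a` as a bounded continuous function on `[1, ∞)`. -/
lemma exists_boundedContinuousFunction (hπ : IsAsymptoticHom π) (a : A) :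
    ∃ f : Ici (1 : ℝ) →ᵇ B, ∀ t, f t = π t a := by
  obtain ⟨T, hT⟩ := eventually_atTop.1
    (hπ.eventually_norm_le (a := a) (r := ‖a‖ + 1) (by positivity) (by linarith))
  obtain ⟨M, hM⟩ := (isCompact_Icc (a := (1 : ℝ)) (b := T)).exists_bound_of_continuousOn
    ((hπ.1 a).mono Icc_subset_Ici_self)
  refine ⟨BoundedContinuousFunction.ofNormedAddCommGroup (fun t : Ici (1 : ℝ) => π t a)
    (hπ.1 a).domRestrict (max M (3 * (‖a‖ + 1))) fun t => ?_, fun t => rfl⟩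
  rcases le_total (t : ℝ) T with h | h
  · exact (hM t ⟨t.2, h⟩).trans (le_max_left _ _)
  · exact (hT t h).trans (le_max_right _ _)

/-- The pairs `(a, f)` with `a ∈ S` and `f` a bounded continuous path in `R`, asymptotic to
`t ↦ π t a` and lifting `μ a` along `χ`. -/
def lifts (hπ : IsAsymptoticHom π) (χ : B →⋆ₙₐ[ℂ] D) (μ : A →⋆ₙₐ[ℂ] D) (S : Submodule ℂ A)
    (R : Submodule ℂ B) : Submodule ℂ (A × (Ici (1 : ℝ) →ᵇ B)) where
  carrier := {p | p.1 ∈ S ∧ (∀ t, p.2 t ∈ R) ∧ (∀ t, χ (p.2 t) = μ p.1) ∧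
    Tendsto (fun t => π t p.1 - p.2 (projIci 1 t)) atTop (𝓝 0)}
  zero_mem' := ⟨S.zero_mem, fun _ => R.zero_mem, fun _ => by simp, by simpa using hπ.tendsto_zero⟩
  add_mem' := by
    rintro p q ⟨hp₁, hp₂, hp₃, hp₄⟩ ⟨hq₁, hq₂, hq₃, hq₄⟩
    refine ⟨S.add_mem hp₁ hq₁, fun t => R.add_mem (hp₂ t) (hq₂ t), fun t => ?_, ?_⟩
    · simp [hp₃, hq₃]
    · have h := (hp₄.add hq₄).sub (hπ.tendsto_add p.1 q.1)
      simp only [sub_zero, add_zero] at h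
      refine h.congr fun t => ?_
      simp only [Prod.fst_add, Prod.snd_add, BoundedContinuousFunction.coe_add, Pi.add_apply]
      abel
  smul_mem' := by
    rintro c p ⟨hp₁, hp₂, hp₃, hp₄⟩
    refine ⟨S.smul_mem c hp₁, fun t => R.smul_mem c (hp₂ t), fun t => ?_, ?_⟩
    · simp [hp₃]
    · have h := (hp₄.const_smul c).sub (hπ.tendsto_smul c p.1)
      simp only [sub_zero, smul_zero] at h
      refine h.congr fun t => ?_
      simp only [Prod.smul_fst, Prod.smul_snd, BoundedContinuousFunction.coe_smul, smul_sub]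
      abel

lemma isClosed_setOf_tendsto (hπ : IsAsymptoticHom π) :
    IsClosed {p : A × (Ici (1 : ℝ) →ᵇ B) |
      Tendsto (fun t => π t p.1 - p.2 (projIci 1 t)) atTop (𝓝 0)} := by
  refine isClosed_of_closure_subset fun p hp => ?_
  rw [mem_ofPred_eq, Metric.tendsto_nhds]
  intro ε hε
  obtain ⟨q, hq, hpq⟩ := Metric.mem_closure_iff.1 hp (ε / 6) (by positivity)
  rw [dist_eq_norm] at hpq
  have hfst : ‖p.1 - q.1‖ ≤ ε / 6 := (norm_fst_le (p - q)).trans hpq.le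
  have hsnd : ‖p.2 - q.2‖ < ε / 6 := (norm_snd_le (p - q)).trans_lt hpq
  have hadd := hπ.tendsto_add (p.1 - q.1) q.1
  rw [sub_add_cancel] at hadd
  have h := hq.sub hadd
  rw [sub_zero] at h
  filter_upwards [hπ.eventually_norm_le (by positivity) hfst,
    (tendsto_zero_iff_norm_tendsto_zero.1 h).eventually_lt_const
      (show 0 < ε / 6 by positivity)] with t h₁ h₂
  have h₃ := (p.2 - q.2).norm_coe_le_norm (projIci 1 t)
  rw [BoundedContinuousFunction.coe_sub, Pi.sub_apply] at h₃
  rw [dist_zero_right]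
  have hdecomp : π t p.1 - p.2 (projIci 1 t)
      = (π t q.1 - q.2 (projIci 1 t) - (π t (p.1 - q.1) + π t q.1 - π t p.1))
        + π t (p.1 - q.1) - (p.2 (projIci 1 t) - q.2 (projIci 1 t)) := by abel
  rw [hdecomp]
  refine (norm_sub_le_of_le (norm_add_le_of_le h₂.le h₁) h₃).trans_lt ?_
  linarith

lemma isClosed_lifts (hπ : IsAsymptoticHom π) (χ : B →⋆ₙₐ[ℂ] D) (μ : A →⋆ₙₐ[ℂ] D)
    {S : Submodule ℂ A} (hS : IsClosed (S : Set A)) {R : Submodule ℂ B}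
    (hR : IsClosed (R : Set B)) :
    IsClosed (hπ.lifts χ μ S R : Set (A × (Ici (1 : ℝ) →ᵇ B))) := by
  have hχ : Continuous χ :=
    AddMonoidHomClass.continuous_of_bound χ 1 (by simpa using NonUnitalStarAlgHom.norm_apply_le χ)
  have hμ : Continuous μ :=
    AddMonoidHomClass.continuous_of_bound μ 1 (by simpa using NonUnitalStarAlgHom.norm_apply_le μ)
  have heval : ∀ t, Continuous fun p : A × (Ici (1 : ℝ) →ᵇ B) => p.2 t := fun t =>
    (continuous_eval_const t).comp continuous_snd
  have h₁ : IsClosed {p : A × (Ici (1 : ℝ) →ᵇ B) | p.1 ∈ S} := hS.preimage continuous_fst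
  have h₂ : IsClosed {p : A × (Ici (1 : ℝ) →ᵇ B) | ∀ t, p.2 t ∈ R} := by
    simp only [ofPred_forall]
    exact isClosed_iInter fun t => hR.preimage (heval t)
  have h₃ : IsClosed {p : A × (Ici (1 : ℝ) →ᵇ B) | ∀ t, χ (p.2 t) = μ p.1} := by
    simp only [ofPred_forall]
    exact isClosed_iInter fun t => isClosed_eq (hχ.comp (heval t)) (hμ.comp continuous_fst)
  exact h₁.inter (h₂.inter (h₃.inter hπ.isClosed_setOf_tendsto))

lemma exists_mem_lifts (hπ : IsAsymptoticHom π) {χ : B →⋆ₙₐ[ℂ] D} {μ : A →⋆ₙₐ[ℂ] D}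
    {S : Submodule ℂ A} {R : Submodule ℂ B}
    (hχπ : ∀ t ∈ Ici (1 : ℝ), ∀ a : A, χ (π t a) = μ a)
    (hSR : ∀ t ∈ Ici (1 : ℝ), ∀ a ∈ S, π t a ∈ R) {a : A} (ha : a ∈ S) :
    ∃ f, (a, f) ∈ hπ.lifts χ μ S R := by
  obtain ⟨f, hf⟩ := hπ.exists_boundedContinuousFunction a
  refine ⟨f, ha, fun t => ?_, fun t => ?_, ?_⟩
  · simpa [hf] using hSR t t.2 a ha
  · simpa [hf] using hχπ t t.2 a
  · refine tendsto_const_nhds.congr' ?_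
    filter_upwards [eventually_ge_atTop 1] with t ht
    simp [hf, projIci_of_mem (show t ∈ Ici 1 from ht)]

end IsAsymptoticHom

/-- A nested pair of closed linear relations `Q ≤ P` between Banach spaces, with `P` everywhere
defined and `Q` defined on a closed subspace `S`, has a continuous selection of `P` whose
restriction to `S` selects `Q`. -/
theorem exists_continuous_selection_of_isClosed_submodule_prod {V W : Type*}
    [NormedAddCommGroup V] [NormedSpace ℂ V] [CompleteSpace V]
    [NormedAddCommGroup W] [NormedSpace ℂ W] [CompleteSpace W]
    {P Q : Submodule ℂ (V × W)} (hP : IsClosed (P : Set (V × W)))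
    (hQ : IsClosed (Q : Set (V × W))) (hQP : Q ≤ P)
    {S : Submodule ℂ V} (hS : IsClosed (S : Set V)) (hQS : ∀ p ∈ Q, p.1 ∈ S)
    (hPsurj : ∀ v, ∃ w, (v, w) ∈ P) (hQsurj : ∀ v ∈ S, ∃ w, (v, w) ∈ Q) :
    ∃ g : C(V, W), (∀ v, (v, g v) ∈ P) ∧ ∀ v ∈ S, (v, g v) ∈ Q := by
  let _ : NormedSpace ℝ W := NormedSpace.complexToReal
  obtain ⟨C, hC, hCP⟩ := exists_norm_le_of_isClosed_submodule_prod P hP ⊤ isClosed_univ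
    (fun _ _ => trivial) fun v _ => hPsurj v
  obtain ⟨C', hC', hCQ⟩ := exists_norm_le_of_isClosed_submodule_prod Q hQ S hS hQS hQsurj
  have hconv : ∀ (L : Submodule ℂ (V × W)) (v : V), Convex ℝ {w | (v, w) ∈ L} := by
    intro L v w₁ h₁ w₂ h₂ s t _ _ hst
    have h := L.add_mem (L.smul_mem (s : ℂ) h₁) (L.smul_mem (t : ℂ) h₂)
    rw [Prod.smul_mk, Prod.smul_mk, Prod.mk_add_mk, ← add_smul, ← Complex.ofReal_add, hst,
      Complex.ofReal_one, one_smul] at h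
    exact h
  have hclosed : ∀ {L : Submodule ℂ (V × W)}, IsClosed (L : Set (V × W)) → ∀ v : V,
      IsClosed {w | (v, w) ∈ L} := fun hL v => hL.preimage (Continuous.prodMk_right v)
  have hsmall : ∀ (K : ℝ) (v : V) (ε : ℝ), 0 < ε → ∀ᶠ v' in 𝓝 v, K * ‖v' - v‖ < ε := by
    intro K v ε hε
    have h : Continuous fun v' : V => K * ‖v' - v‖ := by fun_prop
    exact (h.tendsto v).eventually_lt_const (by simpa using hε)
  have hshift : ∀ {L : Submodule ℂ (V × W)} {K ε : ℝ} {v v' : V} {w : W}, (v, w) ∈ L →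
      K * ‖v' - v‖ < ε → (∃ u, (v' - v, u) ∈ L ∧ ‖u‖ ≤ K * ‖v' - v‖) →
      ∃ w', (v', w') ∈ L ∧ dist w w' < ε := by
    rintro L K ε v v' w hw hK ⟨u, hu, hun⟩
    refine ⟨w + u, by simpa using L.add_mem hw hu, ?_⟩
    rw [dist_self_add_right]
    exact hun.trans_lt hK
  obtain ⟨g, hg⟩ := exists_continuous_selection
    (F := fun v => {w | (v, w) ∈ P} ∩ {w | v ∈ S → (v, w) ∈ Q})
    (fun v => by
      by_cases hv : v ∈ S
      · obtain ⟨w, hw⟩ := hQsurj v hv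
        exact ⟨w, hQP hw, fun _ => hw⟩
      · obtain ⟨w, hw⟩ := hPsurj v
        exact ⟨w, hw, fun h => absurd h hv⟩)
    (fun v => (hclosed hP v).inter (by
      simp only [ofPred_forall]
      exact isClosed_iInter fun _ => hclosed hQ v))
    (fun v => (hconv P v).inter (by
      simp only [ofPred_forall]
      exact convex_iInter fun _ => hconv Q v))
    (fun v w hw ε hε => by
      have hout : ∀ v' ∉ S, C * ‖v' - v‖ < ε →
          ∃ w' ∈ {w | (v', w) ∈ P} ∩ {w | v' ∈ S → (v', w) ∈ Q}, dist w w' < ε := by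
        intro v' hv' hsm
        obtain ⟨w', hw', hd⟩ := hshift hw.1 hsm (hCP _ trivial)
        exact ⟨w', ⟨hw', fun h => absurd h hv'⟩, hd⟩
      by_cases hv : v ∈ S
      · filter_upwards [hsmall C v ε hε, hsmall C' v ε hε] with v' h₁ h₂
        by_cases hv' : v' ∈ S
        · obtain ⟨w', hw', hd⟩ := hshift (hw.2 hv) h₂ (hCQ _ (S.sub_mem hv' hv))
          exact ⟨w', ⟨hQP hw', fun _ => hw'⟩, hd⟩
        · exact hout v' hv' h₁
      · filter_upwards [hsmall C v ε hε, hS.isOpen_compl.mem_nhds hv] with v' h₁ hv'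
        exact hout v' hv' h₁)
  exact ⟨g, fun v => (hg v).1, fun v hv => (hg v).2 hv⟩

theorem statement0 {A B D : Type*} [NonUnitalCStarAlgebra A] [NonUnitalCStarAlgebra B]
    [NonUnitalCStarAlgebra D]
    (A₀ : NonUnitalStarSubalgebra ℂ A) (hA₀ : IsClosed (A₀ : Set A))
    (B₀ : NonUnitalStarSubalgebra ℂ B) (hB₀ : IsClosed (B₀ : Set B))
    (χ : B →⋆ₙₐ[ℂ] D) (μ : A →⋆ₙₐ[ℂ] D)
    (π : ℝ → A → B) (hπ : IsAsymptoticHom π)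
    (hχπ : ∀ t ∈ Set.Ici (1 : ℝ), ∀ a : A, χ (π t a) = μ a)
    (hπ₀ : ∀ t ∈ Set.Ici (1 : ℝ), ∀ a ∈ A₀, π t a ∈ B₀) :
    ∃ πhat : ℝ → A → B, IsAsymptoticHom πhat ∧
      Equicontinuous (fun t : Set.Ici (1 : ℝ) => πhat t) ∧
      (∀ a : A, Tendsto (fun t => ‖π t a - πhat t a‖) atTop (𝓝 0)) ∧
      (∀ t ∈ Set.Ici (1 : ℝ), ∀ a : A, χ (πhat t a) = μ a) ∧
      (∀ t ∈ Set.Ici (1 : ℝ), ∀ a ∈ A₀, πhat t a ∈ B₀) := by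
  let S : Submodule ℂ A := A₀.toNonUnitalSubalgebra.toSubmodule
  let R : Submodule ℂ B := B₀.toNonUnitalSubalgebra.toSubmodule
  obtain ⟨g, hgP, hgQ⟩ := exists_continuous_selection_of_isClosed_submodule_prod
    (P := hπ.lifts χ μ ⊤ ⊤) (Q := hπ.lifts χ μ S R) (S := S)
    (hπ.isClosed_lifts χ μ isClosed_univ isClosed_univ) (hπ.isClosed_lifts χ μ hA₀ hB₀)
    (fun p hp => ⟨trivial, fun _ => trivial, hp.2.2⟩) hA₀ (fun p hp => hp.1)
    (fun a => hπ.exists_mem_lifts (S := ⊤) (R := ⊤) hχπ (fun _ _ _ _ => trivial) trivial)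
    (fun a ha => hπ.exists_mem_lifts hχπ hπ₀ ha)
  have hlim : ∀ a, Tendsto (fun t => π t a - g a (projIci 1 t)) atTop (𝓝 0) :=
    fun a => (hgP a).2.2.2
  refine ⟨fun t a => g a (projIci 1 t), hπ.of_tendsto_sub (fun a => ?_) hlim, ?_,
    fun a => tendsto_zero_iff_norm_tendsto_zero.1 (hlim a), fun t _ a => (hgP a).2.2.1 _,
    fun t _ a ha => (hgQ a ha).2.1 _⟩
  · have hproj : Continuous (projIci (1 : ℝ)) :=
      (continuous_const.max continuous_id).subtype_mk _
    exact ((g a).continuous.comp hproj).continuousOn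
  · intro a
    rw [Metric.equicontinuousAt_iff_right]
    intro ε hε
    have h : Tendsto (fun x => dist (g a) (g x)) (𝓝 a) (𝓝 0) := by
      simpa using (tendsto_const_nhds (x := g a)).dist (g.continuous.tendsto a)
    filter_upwards [h.eventually_lt_const hε] with x hx t
    exact (BoundedContinuousFunction.dist_coe_le_dist _).trans_lt hx
end

section
/- Let D be a C*-algebra and let b ∈ D be a positive element with ‖b‖ ≤ 1 such that the set {b x : x ∈ D} is dense in D. Then there exists a sequence of continuous functions f_n : [0,1] → [0,1], each vanishing on a neighbourhood of 0, such that the elements u_n := f_n(b) (defined via the continuous functional calculus) satisfy u_{n+1}u_n = u_n for all n and lim_{n→∞} ‖u_n x − x‖ = 0 for every x ∈ D. -/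
open Filter Topology

/-- The piecewise linear function vanishing on `(-∞, 2⁻ⁿ]` and equal to `1` on `[2 * 2⁻ⁿ, ∞)`. -/
noncomputable def dyadicRamp (n : ℕ) (t : ℝ) : ℝ := max 0 (min 1 (2 ^ n * t - 1))

lemma continuous_dyadicRamp (n : ℕ) : Continuous (dyadicRamp n) := by
  unfold dyadicRamp
  fun_prop

lemma dyadicRamp_mem_Icc (n : ℕ) (t : ℝ) : dyadicRamp n t ∈ Set.Icc (0 : ℝ) 1 :=
  ⟨le_max_left _ _, max_le zero_le_one (min_le_left _ _)⟩

lemma dyadicRamp_eq_zero {n : ℕ} {t : ℝ} (h : 2 ^ n * t ≤ 1) : dyadicRamp n t = 0 :=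
  max_eq_left ((min_le_right _ _).trans (by linarith))

lemma dyadicRamp_eq_one {n : ℕ} {t : ℝ} (h : 2 ≤ 2 ^ n * t) : dyadicRamp n t = 1 := by
  rw [dyadicRamp, min_eq_left (by linarith), max_eq_right zero_le_one]

lemma dyadicRamp_zero_right (n : ℕ) : dyadicRamp n 0 = 0 :=
  dyadicRamp_eq_zero (by simp)

lemma dyadicRamp_succ_mul (n : ℕ) (t : ℝ) :
    dyadicRamp (n + 1) t * dyadicRamp n t = dyadicRamp n t := by
  rcases le_total (2 ^ n * t) 1 with h | h
  · rw [dyadicRamp_eq_zero h, mul_zero]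
  · rw [dyadicRamp_eq_one (by rw [pow_succ]; linarith), one_mul]

lemma norm_dyadicRamp_mul_sub_le (n : ℕ) {t : ℝ} (ht : 0 ≤ t) :
    ‖dyadicRamp n t * t - t‖ ≤ 2 * (1 / 2) ^ n := by
  rcases le_total 2 (2 ^ n * t) with h | h
  · rw [dyadicRamp_eq_one h]
    simp
  · have ht2 : t ≤ 2 * (1 / 2) ^ n := by
      rw [one_div, inv_pow, ← div_eq_mul_inv, le_div_iff₀ (by positivity)]
      linarith
    obtain ⟨h0, h1⟩ := dyadicRamp_mem_Icc n t
    rw [Real.norm_eq_abs, abs_le]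
    constructor <;> nlinarith

/-- A sequence of contractions `u n` with `u n * b → b` is a left approximate unit as soon as
the right multiples of `b` are dense. -/
lemma tendsto_mul_left_of_denseRange {D : Type*} [NonUnitalNormedRing D] {b : D} {u : ℕ → D}
    (hu : ∀ n, ‖u n‖ ≤ 1) (hub : Tendsto (fun n => u n * b) atTop (𝓝 b))
    (hdense : DenseRange (fun x : D => b * x)) (x : D) :
    Tendsto (fun n => u n * x) atTop (𝓝 x) := by
  rw [Metric.tendsto_atTop]
  intro ε hε
  obtain ⟨y, hy⟩ := hdense.exists_dist_lt x (ε := ε / 3) (by positivity)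
  obtain ⟨N, hN⟩ := Metric.tendsto_atTop.mp (hub.mul_const y) (ε / 3) (by positivity)
  refine ⟨N, fun n hn => ?_⟩
  have hux : dist (u n * x) (u n * b * y) ≤ dist x (b * y) := by
    rw [mul_assoc, dist_eq_norm, dist_eq_norm, ← mul_sub]
    exact (norm_mul_le _ _).trans (mul_le_of_le_one_left (norm_nonneg _) (hu n))
  have htri := dist_triangle4 (u n * x) (u n * b * y) (b * y) x
  have hNn := hN n hn
  rw [dist_comm (b * y) x] at htri
  linarith

/-- Existence of unit sequences: if `b` is a positive element of norm at most one of a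
C*-algebra `D` such that `bD` is dense in `D`, then there is a sequence of continuous
functions `f n : [0,1] → [0,1]`, each vanishing on a neighbourhood of `0`, such that the
elements `u n = f n (b)` (continuous functional calculus) satisfy `u (n+1) * u n = u n`
and `u n • x → x` for every `x ∈ D`. -/
theorem statement3 {D : Type*} [NonUnitalCStarAlgebra D] [PartialOrder D] [StarOrderedRing D]
    (b : D) (hb : 0 ≤ b) (hb1 : ‖b‖ ≤ 1) (hdense : DenseRange (fun x : D => b * x)) :
    ∃ f : ℕ → ℝ → ℝ,
      (∀ n, Continuous (f n)) ∧
      (∀ n, ∀ x ∈ Set.Icc (0 : ℝ) 1, f n x ∈ Set.Icc (0 : ℝ) 1) ∧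
      (∀ n, ∃ ε > (0 : ℝ), ∀ x : ℝ, x ≤ ε → f n x = 0) ∧
      (∀ n, cfcₙ (f (n + 1)) b * cfcₙ (f n) b = cfcₙ (f n) b) ∧
      (∀ x : D, Tendsto (fun n : ℕ => ‖cfcₙ (f n) b * x - x‖) atTop (𝓝 0)) := by
  have hsa : IsSelfAdjoint b := .of_nonneg hb
  have hcont (n : ℕ) (s : Set ℝ) : ContinuousOn (dyadicRamp n) s :=
    (continuous_dyadicRamp n).continuousOn
  have hzero := dyadicRamp_zero_right
  refine ⟨dyadicRamp, continuous_dyadicRamp, fun n x _ => dyadicRamp_mem_Icc n x,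
    fun n => ⟨(2 ^ n)⁻¹, by positivity, fun x hx => dyadicRamp_eq_zero ?_⟩, fun n => ?_,
    fun x => tendsto_iff_norm_sub_tendsto_zero.mp
      (tendsto_mul_left_of_denseRange (fun n => ?_) ?_ hdense x)⟩
  · calc (2 : ℝ) ^ n * x ≤ 2 ^ n * (2 ^ n)⁻¹ := by gcongr
      _ = 1 := mul_inv_cancel₀ (by positivity)
  · rw [← cfcₙ_mul (dyadicRamp (n + 1)) (dyadicRamp n) b (hcont _ _) (hzero _) (hcont _ _)
      (hzero _)]
    simp only [dyadicRamp_succ_mul]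
  · refine norm_cfcₙ_le fun t _ => ?_
    obtain ⟨h0, h1⟩ := dyadicRamp_mem_Icc n t
    rwa [Real.norm_of_nonneg h0]
  · rw [tendsto_iff_norm_sub_tendsto_zero]
    have hgeom : Tendsto (fun n : ℕ => 2 * (1 / 2 : ℝ) ^ n) atTop (𝓝 0) := by
      simpa using (tendsto_pow_atTop_nhds_zero_of_lt_one (r := (1 / 2 : ℝ))
        (by norm_num) (by norm_num)).const_mul 2
    refine squeeze_zero (fun _ => norm_nonneg _) (fun n => ?_) hgeom
    have hcfc : cfcₙ (fun t => dyadicRamp n t * t - t) b = cfcₙ (dyadicRamp n) b * b - b := by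
      rw [cfcₙ_sub (fun t => dyadicRamp n t * t) (fun t => t) b
          ((hcont _ _).mul continuousOn_id) (by simp) continuousOn_id rfl,
        cfcₙ_mul (dyadicRamp n) (fun t => t) b (hcont _ _) (hzero _) continuousOn_id rfl,
        cfcₙ_id' ℝ b]
    rw [← hcfc]
    exact norm_cfcₙ_le fun t ht =>
      norm_dyadicRamp_mul_sub_le n (quasispectrum_nonneg_of_nonneg b hb t ht)
end

section
/- Let D be a C*-algebra, b ∈ D a positive element with ‖b‖ ≤ 1, and f_n : [0,1] → [0,1] (n ≥ 0) continuous functions, each vanishing on a neighbourhood of 0, such that the elements u_n := f_n(b) satisfy u_{n+1}u_n = u_n for all n ≥ 0. Then 0 ≤ u_n ≤ u_{n+1} ≤ 1 for all n, and setting Δ₀ := u₀^{1/2} and Δ_j := (u_j − u_{j−1})^{1/2} for j ≥ 1, one has Δ_i Δ_j = 0 whenever |i − j| ≥ 2. -/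
open Filter Topology

/-- If `t (n + 1) * t n = t n` for all `n`, all terms after a nonzero one equal `1`. -/
lemma eq_one_of_lt_of_ne_zero {t : ℕ → ℝ} (ht : ∀ n, t (n + 1) * t n = t n) {m n : ℕ}
    (hmn : m < n) (hm : t m ≠ 0) : t n = 1 := by
  induction n, hmn using Nat.le_induction with
  | base => exact mul_right_cancel₀ hm (by rw [ht, one_mul])
  | succ n _ ih => simpa [ih] using ht n

/-- The successive differences of a sequence of functions, starting with its first term. -/
def increment (f : ℕ → ℝ → ℝ) : ℕ → ℝ → ℝ
  | 0 => f 0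
  | j + 1 => fun x ↦ f (j + 1) x - f j x

lemma continuous_increment {f : ℕ → ℝ → ℝ} (hf : ∀ n, Continuous (f n)) :
    ∀ j, Continuous (increment f j)
  | 0 => hf 0
  | j + 1 => (hf (j + 1)).sub (hf j)

lemma increment_apply_eq_zero {f : ℕ → ℝ → ℝ} {x : ℝ} (hf : ∀ n, f n x = 0) (j : ℕ) :
    increment f j x = 0 := by
  cases j <;> simp [increment, hf]

lemma increment_eq_zero_or_eq_zero {f : ℕ → ℝ → ℝ} {x : ℝ}
    (hf : ∀ n, f (n + 1) x * f n x = f n x) {i j : ℕ} (hij : i + 2 ≤ j) :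
    increment f i x = 0 ∨ increment f j x = 0 := by
  obtain ⟨k, rfl⟩ : ∃ k, j = k + 1 := ⟨j - 1, by lia⟩
  by_cases hi : f i x = 0
  · left
    cases i with
    | zero => exact hi
    | succ l =>
      have hl : f l x = 0 := by rw [← hf l, hi, zero_mul]
      simp [increment, hi, hl]
  · right
    have h {n : ℕ} (hn : i < n) : f n x = 1 :=
      eq_one_of_lt_of_ne_zero (t := fun n ↦ f n x) hf hn hi
    simp [increment, h (show i < k by lia), h (show i < k + 1 by lia)]

lemma CFC.sqrt_cfcₙ {D : Type*} [NonUnitalCStarAlgebra D] [PartialOrder D] [StarOrderedRing D]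
    {b : D} (hb : IsSelfAdjoint b) {g : ℝ → ℝ} (hg : Continuous g) (hg0 : g 0 = 0)
    (hg_nonneg : ∀ x ∈ quasispectrum ℝ b, 0 ≤ g x) :
    CFC.sqrt (cfcₙ g b) = cfcₙ (fun x ↦ √(g x)) b := by
  rw [CFC.sqrt_eq_real_sqrt _ (cfcₙ_nonneg hg_nonneg),
    cfcₙ_comp' Real.sqrt g b Real.continuous_sqrt.continuousOn Real.sqrt_zero
      hg.continuousOn hg0 hb]

/-- If `u n = f n (b)` is a unit sequence built from a positive contraction `b`
(`u (n+1) * u n = u n`), then the `u n` increase, lie between `0` and `1`, and the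
square roots `Δ 0 = (u 0)^{1/2}`, `Δ (j+1) = (u (j+1) - u j)^{1/2}` satisfy
`Δ i * Δ j = 0` whenever `|i - j| ≥ 2`. -/
theorem statement4 {D : Type*} [NonUnitalCStarAlgebra D] [PartialOrder D] [StarOrderedRing D]
    (b : D) (hb : 0 ≤ b) (hb1 : ‖b‖ ≤ 1)
    (f : ℕ → ℝ → ℝ) (hf_cont : ∀ n, Continuous (f n))
    (hf_range : ∀ n, ∀ x ∈ Set.Icc (0 : ℝ) 1, f n x ∈ Set.Icc (0 : ℝ) 1)
    (hf_zero : ∀ n, ∃ ε > (0 : ℝ), ∀ x : ℝ, x ≤ ε → f n x = 0)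
    (u : ℕ → D) (hu : ∀ n, u n = cfcₙ (f n) b)
    (huu : ∀ n, u (n + 1) * u n = u n)
    (Δ : ℕ → D) (hΔ0 : Δ 0 = CFC.sqrt (u 0))
    (hΔ : ∀ j : ℕ, Δ (j + 1) = CFC.sqrt (u (j + 1) - u j)) :
    (∀ n, 0 ≤ u n) ∧ (∀ n, u n ≤ u (n + 1)) ∧ (∀ n, ‖u n‖ ≤ 1) ∧
      (∀ i j : ℕ, (i + 2 ≤ j ∨ j + 2 ≤ i) → Δ i * Δ j = 0) := by
  have hsa : IsSelfAdjoint b := .of_nonneg hb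
  have hc (n : ℕ) : ContinuousOn (f n) (quasispectrum ℝ b) := (hf_cont n).continuousOn
  have hf0 (n : ℕ) : f n 0 = 0 := by
    obtain ⟨ε, hε, h⟩ := hf_zero n
    exact h 0 hε.le
  have hmem {x : ℝ} (hx : x ∈ quasispectrum ℝ b) (n : ℕ) : f n x ∈ Set.Icc (0 : ℝ) 1 :=
    hf_range n x ⟨quasispectrum_nonneg_of_nonneg b hb x hx, (le_abs_self x).trans <|
      (NonUnitalIsometricContinuousFunctionalCalculus.norm_quasispectrum_le b hx hsa).trans hb1⟩
  have hmul {x : ℝ} (hx : x ∈ quasispectrum ℝ b) (n : ℕ) : f (n + 1) x * f n x = f n x := by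
    have h := huu n
    rw [hu, hu, ← cfcₙ_mul (f (n + 1)) (f n) b (hc _) (hf0 _) (hc _) (hf0 _)] at h
    exact eqOn_of_cfcₙ_eq_cfcₙ h hsa ((hc _).mul (hc _)) (by simp [hf0]) (hc _) (hf0 _) hx
  have hmono {x : ℝ} (hx : x ∈ quasispectrum ℝ b) (n : ℕ) : f n x ≤ f (n + 1) x :=
    (hmul hx n).symm.trans_le <| mul_le_of_le_one_right (hmem hx _).1 (hmem hx _).2
  have hinc {x : ℝ} (hx : x ∈ quasispectrum ℝ b) : ∀ j, 0 ≤ increment f j x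
    | 0 => (hmem hx 0).1
    | j + 1 => sub_nonneg.2 (hmono hx j)
  have hinc0 (j : ℕ) : increment f j 0 = 0 := increment_apply_eq_zero hf0 j
  have hΔ_eq (j : ℕ) : Δ j = cfcₙ (fun x ↦ √(increment f j x)) b := by
    rw [← CFC.sqrt_cfcₙ hsa (continuous_increment hf_cont j) (hinc0 j) fun x hx ↦ hinc hx j]
    cases j with
    | zero => rw [hΔ0, hu, increment]
    | succ j =>
      rw [hΔ, hu, hu, increment, cfcₙ_sub (f (j + 1)) (f j) b (hc _) (hf0 _) (hc _) (hf0 _)]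
  refine ⟨fun n ↦ ?_, fun n ↦ ?_, fun n ↦ ?_, fun i j hij ↦ ?_⟩
  · exact hu n ▸ cfcₙ_nonneg fun x hx ↦ (hmem hx n).1
  · rw [hu, hu]
    exact cfcₙ_mono (fun x hx ↦ hmono hx n) (hc _) (hc _) (hf0 _) (hf0 _)
  · rw [hu]
    refine norm_cfcₙ_le fun x hx ↦ ?_
    rw [Real.norm_of_nonneg (hmem hx n).1]
    exact (hmem hx n).2
  · have hsqrt (k : ℕ) : ContinuousOn (fun x ↦ √(increment f k x)) (quasispectrum ℝ b) :=
      (continuous_increment hf_cont k).sqrt.continuousOn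
    rw [hΔ_eq, hΔ_eq, ← cfcₙ_mul _ _ b (hsqrt i) (by simp [hinc0]) (hsqrt j) (by simp [hinc0]),
      ← cfcₙ_zero ℝ b]
    refine cfcₙ_congr fun x hx ↦ ?_
    have h : increment f i x = 0 ∨ increment f j x = 0 := hij.elim
      (increment_eq_zero_or_eq_zero (hmul hx))
      fun h ↦ (increment_eq_zero_or_eq_zero (hmul hx) h).symm
    rcases h with h | h <;> simp [h]
end

section
/- Define continuous real-valued functions on [0,1]: s(t) = sin(πt), c₀(t) = |cos(πt)| for t ∈ [0,1/2] and c₀(t) = 0 for t ∈ (1/2,1], and c₁(t) = 0 for t ∈ [0,1/2] and c₁(t) = |cos(πt)| for t ∈ (1/2,1]. The functions s², s·c₀ and s·c₁ are continuous and take equal values at 0 and 1, hence define continuous functions f, g, h on the unit circle 𝕋 via the parametrization z = e^{2πit}. Let A be a unital C*-algebra and S, T ∈ A unitaries with ST = TS. Then the element P(S,T) = [[f(S), g(S) + h(S)T], [T*h(S) + g(S), 1 − f(S)]] of M₂(A), where f(S), g(S), h(S) are defined by the continuous functional calculus of the unitary (normal) element S, is a projection: P(S,T)* = P(S,T) and P(S,T)²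 = P(S,T). -/
open Filter Topology

/-- Every point of the unit circle is `e^{2πit}` for some `t ∈ [0,1]`. -/
lemma exists_exp_two_pi_I_mul_eq {z : ℂ} (hz : ‖z‖ = 1) :
    ∃ t ∈ Set.Icc (0 : ℝ) 1, Complex.exp (2 * Real.pi * Complex.I * t) = z := by
  obtain ⟨θ, hθ⟩ := (Complex.norm_eq_one_iff z).1 hz
  refine ⟨Int.fract (θ / (2 * Real.pi)), ⟨Int.fract_nonneg _, (Int.fract_lt_one _).le⟩, ?_⟩
  rw [← hθ, Complex.exp_eq_exp_iff_exists_int]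
  refine ⟨-⌊θ / (2 * Real.pi)⌋, ?_⟩
  have hpi : (Real.pi : ℂ) ≠ 0 := by exact_mod_cast Real.pi_ne_zero
  rw [Int.fract]
  push_cast
  field_simp
  ring

/-- A self-adjoint `2 × 2` matrix `[[F, G + HT], [T*H + G, 1 - F]]` with commuting entries,
`T` unitary, `GH = 0` and `F² + G² + H² = F` is a projection. -/
lemma star_eq_and_mul_self_eq_of_commute {A : Type*} [Ring A] [StarRing A] {F G H T : A}
    (hT : T ∈ unitary A) (hF : star F = F) (hG : star G = G) (hH : star H = H)
    (hFG : Commute F G) (hFH : Commute F H) (hTF : Commute T F) (hTG : Commute T G)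
    (hTH : Commute T H) (hGH : G * H = 0) (hHG : H * G = 0)
    (hsum : F * F + G * G + H * H = F) :
    star !![F, G + H * T; star T * H + G, 1 - F] = !![F, G + H * T; star T * H + G, 1 - F] ∧
      !![F, G + H * T; star T * H + G, 1 - F] * !![F, G + H * T; star T * H + G, 1 - F] =
        !![F, G + H * T; star T * H + G, 1 - F] := by
  have hTF' : Commute (star T) F := by simpa [hF] using hTF.star_star
  have hTG' : Commute (star T) G := by simpa [hG] using hTG.star_star
  have hTT : star T * T = 1 := Unitary.star_mul_self_of_mem hT
  have hTT' : T * star T = 1 := Unitary.mul_star_self_of_mem hT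
  have hGTH : G * (star T * H) = 0 := by
    rw [← mul_assoc, ← hTG'.eq, mul_assoc, hGH, mul_zero]
  have hHTG : H * T * G = 0 := by rw [mul_assoc, hTG.eq, ← mul_assoc, hHG, zero_mul]
  have hHTTH : H * T * (star T * H) = H * H := by
    rw [mul_assoc, ← mul_assoc T, hTT', one_mul]
  have hTHG : star T * H * G = 0 := by rw [mul_assoc, hHG, mul_zero]
  have hGHT : G * (H * T) = 0 := by rw [← mul_assoc, hGH, zero_mul]
  have hTHHT : star T * H * (H * T) = H * H := by
    rw [← hTH.eq, mul_assoc, ← mul_assoc H, ← hTH.eq, mul_assoc, ← mul_assoc, hTT, one_mul]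
  have hoff : F * (H * T) = H * T * F := (hFH.mul_right hTF.symm).eq
  have hoff' : star T * H * F = F * (star T * H) := (hTF'.mul_left hFH.symm).eq
  refine ⟨?_, ?_⟩
  · ext i j
    fin_cases i <;> fin_cases j <;>
      simp [Matrix.star_apply, hF, hG, hH, add_comm]
  · rw [Matrix.mul_fin_two]
    congr! 3
    · rw [mul_add, add_mul, add_mul, hHTTH, hGTH, hHTG]
      linear_combination (norm := noncomm_ring) hsum
    · congr! 1
      rw [mul_add, mul_sub, mul_one, add_mul _ _ F, hoff, hFG.eq]
      abel
    · congr! 1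
      · rw [add_mul, sub_mul, one_mul, mul_add F, hoff', hFG.eq]
        abel
      · congr! 1
        rw [mul_add, add_mul, add_mul, hTHHT, hTHG, hGHT]
        linear_combination (norm := noncomm_ring) hsum

/-- The Bott projection associated to a pair of commuting unitaries `S`, `T` in a unital
C*-algebra.  The continuous functions `f`, `g`, `h` on the unit circle are determined (via the
parametrization `z = e^{2πit}`, `t ∈ [0,1]`) by `s(t)² = sin²(πt)`,
`s(t)c₀(t) = sin(πt)·|cos(πt)|·1_{[0,1/2]}(t)` and `s(t)c₁(t) = sin(πt)·|cos(πt)|·1_{(1/2,1]}(t)`,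
and the matrix `P(S,T) = [[f(S), g(S) + h(S)T], [T*h(S) + g(S), 1 - f(S)]]` is a projection. -/
theorem statement5 {A : Type*} [CStarAlgebra A]
    (S T : A) (hS : S ∈ unitary A) (hT : T ∈ unitary A) (hST : S * T = T * S)
    (f g h : ℂ → ℂ) (hf : Continuous f) (hg : Continuous g) (hh : Continuous h)
    (hfv : ∀ t ∈ Set.Icc (0 : ℝ) 1,
      f (Complex.exp (2 * Real.pi * Complex.I * t)) = ((Real.sin (Real.pi * t)) ^ 2 : ℝ))
    (hgv : ∀ t ∈ Set.Icc (0 : ℝ) 1,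
      g (Complex.exp (2 * Real.pi * Complex.I * t)) =
        ((Real.sin (Real.pi * t) *
          (if t ≤ 1 / 2 then |Real.cos (Real.pi * t)| else 0) : ℝ)))
    (hhv : ∀ t ∈ Set.Icc (0 : ℝ) 1,
      h (Complex.exp (2 * Real.pi * Complex.I * t)) =
        ((Real.sin (Real.pi * t) *
          (if t ≤ 1 / 2 then 0 else |Real.cos (Real.pi * t)|) : ℝ)))
    (P : Matrix (Fin 2) (Fin 2) A)
    (hP : P = !![cfc f S, cfc g S + cfc h S * T;
                 star T * cfc h S + cfc g S, 1 - cfc f S]) :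
    star P = P ∧ P * P = P := by
  have hN : IsStarNormal S := ⟨(Unitary.star_mul_self_of_mem hS).trans
    (Unitary.mul_star_self_of_mem hS).symm⟩
  have hTS' : Commute (star S) T := by
    calc star S * T = star S * (T * S) * star S := by
          rw [mul_assoc, mul_assoc, Unitary.mul_star_self_of_mem hS, mul_one]
      _ = T * star S := by
          rw [← hST, ← mul_assoc, Unitary.star_mul_self_of_mem hS, one_mul]
  have hcomm (k : ℂ → ℂ) : Commute T (cfc k S) := (Commute.cfc hST hTS' k).symm
  have hparam {z : ℂ} (hz : z ∈ spectrum ℂ S) :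
      ∃ t ∈ Set.Icc (0 : ℝ) 1, Complex.exp (2 * Real.pi * Complex.I * t) = z :=
    exists_exp_two_pi_I_mul_eq (by simpa using spectrum.subset_circle_of_unitary hS hz)
  have hGH : cfc g S * cfc h S = 0 := by
    rw [← cfc_mul g h S, ← cfc_zero ℂ S]
    refine cfc_congr fun z hz ↦ ?_
    obtain ⟨t, ht, rfl⟩ := hparam hz
    simp only [hgv t ht, hhv t ht]
    split_ifs <;> simp
  subst hP
  refine star_eq_and_mul_self_eq_of_commute hT ?_ ?_ ?_ (cfc_commute_cfc f g S)
    (cfc_commute_cfc f h S) (hcomm f) (hcomm g) (hcomm h) hGH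
    ((cfc_commute_cfc g h S).eq ▸ hGH) ?_
  iterate 3
    rw [← cfc_star]
    refine cfc_congr fun z hz ↦ ?_
    obtain ⟨t, ht, rfl⟩ := hparam hz
    simp only [hfv t ht, hgv t ht, hhv t ht, Complex.star_def, Complex.conj_ofReal]
  rw [← cfc_mul f f S, ← cfc_mul g g S, ← cfc_mul h h S, ← cfc_add .., ← cfc_add ..]
  refine cfc_congr fun z hz ↦ ?_
  obtain ⟨t, ht, rfl⟩ := hparam hz
  simp only [hfv t ht, hgv t ht, hhv t ht]
  norm_cast
  have hsc := Real.sin_sq_add_cos_sq (Real.pi * t)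
  have habs := sq_abs (Real.cos (Real.pi * t))
  split_ifs
  all_goals linear_combination Real.sin (Real.pi * t) ^ 2 * (hsc + habs)
end

section
/- Let A, B, D be C*-algebras and let π_+, π_− : M(B) → M(D) be *-homomorphisms such that π_+(b) − π_−(b) ∈ D for every b ∈ B. Let ψ = (ψ_t)_{t∈[1,∞)} : A → M₂(M(B)) be an equi-continuous asymptotic homomorphism, with matrix entries ψ_t(a) = (ψ^t_{jk}(a))_{j,k=1,2}, such that ψ_t(a) − ψ_1(a) ∈ M₂(B) and ψ^t_{12}(a), ψ^t_{21}(a) ∈ B for all t ∈ [1,∞) and a ∈ A. Define (π_± × ψ)_t(a) ∈ M₂(M(D)) to be the matrix [[π_+(ψ^t_{11}(a)), π_+(ψ^t_{12}(a))], [π_+(ψ^t_{21}(a)), π_−(ψ^t_{22}(a))]]. Then (π_± × ψ) is an asymptotic homomorphism modulo M₂(D): for all a, b ∈ A and λ ∈ ℂ, the norm distance to the ideal M₂(D) of each of the elements (π_±×ψ)_t(a)(π_±×ψ)_t(b) − (π_±×ψ)_t(ab), (π_±×ψ)_t(a) + λ(π_±×ψ)_t(b) − (π_±×ψ)_t(a+λb),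 and (π_±×ψ)_t(a)* − (π_±×ψ)_t(a*) tends to 0 as t → ∞, and t ↦ (π_±×ψ)_t(a) is norm-continuous for each a. -/
open Filter Topology

attribute [local instance] Matrix.normedAddCommGroup

section CornerMap

variable {MB MD : Type*} [CStarAlgebra MB] [CStarAlgebra MD] (πp πm : MB →⋆ₙₐ[ℂ] MD)

/-- Apply `πp` to every entry of a 2 × 2 matrix but the lower right one, and `πm` to that one. -/
noncomputable def cornerMap (X : Matrix (Fin 2) (Fin 2) MB) : Matrix (Fin 2) (Fin 2) MD :=
  !![πp (X 0 0), πp (X 0 1); πp (X 1 0), πm (X 1 1)]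

lemma cornerMap_add_smul (X Y : Matrix (Fin 2) (Fin 2) MB) (c : ℂ) :
    cornerMap πp πm (X + c • Y) = cornerMap πp πm X + c • cornerMap πp πm Y := by
  ext i j
  fin_cases i <;> fin_cases j <;> simp [cornerMap]

lemma cornerMap_sub (X Y : Matrix (Fin 2) (Fin 2) MB) :
    cornerMap πp πm (X - Y) = cornerMap πp πm X - cornerMap πp πm Y := by
  ext i j
  fin_cases i <;> fin_cases j <;> simp [cornerMap]

lemma cornerMap_star (X : Matrix (Fin 2) (Fin 2) MB) :
    cornerMap πp πm (star X) = star (cornerMap πp πm X) := by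
  ext i j
  fin_cases i <;> fin_cases j <;> simp [cornerMap, Matrix.star_apply, map_star]

lemma norm_cornerMap_le (X : Matrix (Fin 2) (Fin 2) MB) : ‖cornerMap πp πm X‖ ≤ ‖X‖ := by
  refine (Matrix.norm_le_iff (norm_nonneg X)).2 fun i j => ?_
  refine le_trans ?_ (Matrix.norm_entry_le_entrywise_sup_norm X (i := i) (j := j))
  fin_cases i <;> fin_cases j <;>
    simpa [cornerMap] using NonUnitalStarAlgHom.norm_apply_le _ _

lemma continuous_cornerMap : Continuous (cornerMap πp πm) := by
  refine (LipschitzWith.of_dist_le_mul (K := 1) fun X Y => ?_).continuous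
  simpa [dist_eq_norm, cornerMap_sub] using norm_cornerMap_le πp πm (X - Y)

variable {πp πm} {B : TwoSidedIdeal MB} {D : TwoSidedIdeal MD}

/-- `cornerMap` is multiplicative modulo `M₂(D)` on matrices with off-diagonal entries in `B`. -/
lemma cornerMap_mul_sub_mem (hπ : ∀ b ∈ B, πp b - πm b ∈ D) {X Y : Matrix (Fin 2) (Fin 2) MB}
    (hX : X 0 1 ∈ B ∧ X 1 0 ∈ B) (hY : Y 0 1 ∈ B ∧ Y 1 0 ∈ B) (i j : Fin 2) :
    (cornerMap πp πm X * cornerMap πp πm Y - cornerMap πp πm (X * Y)) i j ∈ D := by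
  have right {b : MB} (hb : b ∈ B) (m : MB) : πp b * πm m - πp b * πp m ∈ D := by
    have h := D.sub_mem (D.mul_mem_right _ (πm m) (hπ b hb)) (hπ (b * m) (B.mul_mem_right b m hb))
    convert h using 1
    simp only [map_mul]
    noncomm_ring
  have left {b : MB} (hb : b ∈ B) (m : MB) : πm m * πp b - πp m * πp b ∈ D := by
    have h := D.sub_mem (D.mul_mem_left (πm m) _ (hπ b hb)) (hπ (m * b) (B.mul_mem_left m b hb))
    convert h using 1
    simp only [map_mul]
    noncomm_ring
  fin_cases i <;> fin_cases j
  · simp [cornerMap, Matrix.mul_apply, D.zero_mem]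
  · simpa [cornerMap, Matrix.mul_apply] using right hX.1 (Y 1 1)
  · simpa [cornerMap, Matrix.mul_apply] using left hY.2 (X 1 1)
  · simpa [cornerMap, Matrix.mul_apply] using hπ _ (B.mul_mem_left (X 1 0) _ hY.1)

end CornerMap

/-- Lemma 2.2 (Lemma `U2`):  `(π_± × ψ)` is an asymptotic homomorphism modulo `M₂(D)`.
Here `M(B)` and `M(D)` are modelled as unital C*-algebras `MB`, `MD` containing `B`, `D` as
closed two-sided ideals. -/
theorem statement9 {A MB MD : Type*} [NonUnitalCStarAlgebra A]
    [CStarAlgebra MB] [CStarAlgebra MD]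
    (B : TwoSidedIdeal MB) (hB : IsClosed (B : Set MB))
    (D : TwoSidedIdeal MD) (hD : IsClosed (D : Set MD))
    (πp πm : MB →⋆ₙₐ[ℂ] MD) (hπ : ∀ b ∈ B, πp b - πm b ∈ D)
    (ψ : ℝ → A → Matrix (Fin 2) (Fin 2) MB)
    (hψ : IsAsymptoticHom ψ)
    (hψ_equi : Equicontinuous (fun t : Set.Ici (1 : ℝ) => ψ t))
    (hψ_const : ∀ t ∈ Set.Ici (1 : ℝ), ∀ a : A, ∀ i j : Fin 2, ψ t a i j - ψ 1 a i j ∈ B)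
    (hψ_off : ∀ t ∈ Set.Ici (1 : ℝ), ∀ a : A, ψ t a 0 1 ∈ B ∧ ψ t a 1 0 ∈ B)
    (Ξ : ℝ → A → Matrix (Fin 2) (Fin 2) MD)
    (hΞ : ∀ t : ℝ, ∀ a : A, Ξ t a =
      !![πp (ψ t a 0 0), πp (ψ t a 0 1); πp (ψ t a 1 0), πm (ψ t a 1 1)]) :
    (∀ a : A, ContinuousOn (fun t => Ξ t a) (Set.Ici 1)) ∧
    (∀ a b : A, Tendsto (fun t =>
        Metric.infDist (Ξ t a * Ξ t b - Ξ t (a * b))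
          {x : Matrix (Fin 2) (Fin 2) MD | ∀ i j : Fin 2, x i j ∈ D}) atTop (𝓝 0)) ∧
    (∀ (a b : A) (c : ℂ), Tendsto (fun t =>
        Metric.infDist (Ξ t a + c • Ξ t b - Ξ t (a + c • b))
          {x : Matrix (Fin 2) (Fin 2) MD | ∀ i j : Fin 2, x i j ∈ D}) atTop (𝓝 0)) ∧
    (∀ a : A, Tendsto (fun t =>
        Metric.infDist (star (Ξ t a) - Ξ t (star a))
          {x : Matrix (Fin 2) (Fin 2) MD | ∀ i j : Fin 2, x i j ∈ D}) atTop (𝓝 0)) := by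
  obtain ⟨hcont, hmul, hlin, hstar⟩ := hψ
  obtain rfl : Ξ = fun t a => cornerMap πp πm (ψ t a) := funext₂ hΞ
  refine ⟨fun a => (continuous_cornerMap πp πm).comp_continuousOn (hcont a),
    fun a b => ?_, fun a b c => ?_, fun a => ?_⟩
  · refine squeeze_zero' (.of_forall fun _ => Metric.infDist_nonneg) ?_ (hmul a b)
    filter_upwards [eventually_ge_atTop 1] with t ht
    refine (Metric.infDist_le_dist_of_mem (Set.mem_ofPred.2
      (cornerMap_mul_sub_mem hπ (hψ_off t ht a) (hψ_off t ht b)))).trans ?_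
    rw [dist_eq_norm, sub_sub_sub_cancel_left, ← cornerMap_sub]
    exact norm_cornerMap_le πp πm _
  · refine squeeze_zero (fun _ => Metric.infDist_nonneg) (fun t => ?_) (hlin a b c)
    refine (Metric.infDist_le_dist_of_mem ((Set.mem_ofPred (a := 0)).2 fun _ _ => D.zero_mem)).trans ?_
    rw [dist_zero_right, ← cornerMap_add_smul, ← cornerMap_sub]
    exact norm_cornerMap_le πp πm _
  · refine squeeze_zero (fun _ => Metric.infDist_nonneg) (fun t => ?_) (hstar a)
    refine (Metric.infDist_le_dist_of_mem ((Set.mem_ofPred (a := 0)).2 fun _ _ => D.zero_mem)).trans ?_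
    rw [dist_zero_right, ← cornerMap_star, ← cornerMap_sub]
    exact norm_cornerMap_le πp πm _
end

section
/- Let A, B, D be C*-algebras and let π_+, π_− : M(B) → M(D) be *-homomorphisms with π_+(b) − π_−(b) ∈ D for every b ∈ B. Let φ, ψ : A → M₂(M(B)) be equi-continuous asymptotic homomorphisms whose off-diagonal matrix entries lie in B and which satisfy φ_t(a) − φ_1(a) ∈ M₂(B) and ψ_t(a) − ψ_1(a) ∈ M₂(B) for all t, a. Let V₁, V₂ ∈ M(B) be isometries with V₁V₁* + V₂V₂* = 1, and define λ_t : A → M₂(M(B)) entrywise by λ^t_{jk}(a) = V₁ψ^t_{jk}(a)V₁* + V₂φ^t_{jk}(a)V₂*. Then: (i) λ is an asymptotic homomorphism with λ^t_{12}(a), λ^t_{21}(a) ∈ B and λ_t(a) − λ_1(a) ∈ M₂(B) for all t, a; (ii) setting S_i = diag(π_+(V_i), π_−(V_i)) + diag(1 − π_+(1), 1 − π_−(1)) ∈ M₂(M(D)) for i = 1, 2, each S_i satisfies S_i*S_i = 1, and (π_± × λ)_t(a) − S₁(π_± × ψ)_t(a)S₁* − S₂(π_± × φ)_t(a)S₂*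 ∈ M₂(D) for all t ∈ [1,∞) and a ∈ A, where for χ ∈ {φ, ψ, λ}, (π_± × χ)_t(a) denotes the matrix [[π_+(χ^t_{11}(a)), π_+(χ^t_{12}(a))], [π_+(χ^t_{21}(a)), π_−(χ^t_{22}(a))]]. -/
open Filter Topology

attribute [local instance] Matrix.normedAddCommGroup

section DirectSum

variable {R : Type*}

/-- The entrywise sum `V * X * V⋆ + W * Y * W⋆` of two matrices along a pair `V`, `W`. -/
def isometrySum [NonUnitalSemiring R] [Star R] (V W : R)
    (X Y : Matrix (Fin 2) (Fin 2) R) : Matrix (Fin 2) (Fin 2) R :=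
  Matrix.of fun i j => V * X i j * star V + W * Y i j * star W

theorem star_mul_eq_zero_of_isometry_sum [Ring R] [StarRing R] {V W : R}
    (hV : star V * V = 1) (hW : star W * W = 1) (hVW : V * star V + W * star W = 1) :
    star V * W = 0 := by
  have h : star V * (V * star V + W * star W) * W = star V * W := by rw [hVW, mul_one]
  have h' : star V * (V * star V + W * star W) * W =
      star V * V * (star V * W) + star V * W * (star W * W) := by noncomm_ring
  rw [h', hV, hW, one_mul, mul_one] at h
  simpa using h

theorem isometrySum_mul [Ring R] [StarRing R] {V W : R}
    (hV : star V * V = 1) (hW : star W * W = 1) (hVW : V * star V + W * star W = 1)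
    (X Y X' Y' : Matrix (Fin 2) (Fin 2) R) :
    isometrySum V W X Y * isometrySum V W X' Y' = isometrySum V W (X * X') (Y * Y') := by
  have h₁ := star_mul_eq_zero_of_isometry_sum hV hW hVW
  have h₂ := star_mul_eq_zero_of_isometry_sum hW hV (by rwa [add_comm])
  have key (x y x' y' : R) :
      (V * x * star V + W * y * star W) * (V * x' * star V + W * y' * star W) =
        V * (x * x') * star V + W * (y * y') * star W := by
    calc
      _ = V * x * (star V * V) * x' * star V + V * x * (star V * W) * y' * star W +
          W * y * (star W * V) * x' * star V + W * y * (star W * W) * y' * star W := by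
        noncomm_ring
      _ = _ := by rw [hV, hW, h₁, h₂]; noncomm_ring
  ext i j
  simp only [isometrySum, Matrix.mul_apply, Matrix.of_apply, Fin.sum_univ_two, key]
  noncomm_ring

theorem isometrySum_add [Ring R] [StarRing R] (V W : R) (X Y X' Y' : Matrix (Fin 2) (Fin 2) R) :
    isometrySum V W X Y + isometrySum V W X' Y' = isometrySum V W (X + X') (Y + Y') := by
  ext i j
  simp only [isometrySum, Matrix.add_apply, Matrix.of_apply]
  noncomm_ring

theorem isometrySum_sub [Ring R] [StarRing R] (V W : R) (X Y X' Y' : Matrix (Fin 2) (Fin 2) R) :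
    isometrySum V W X Y - isometrySum V W X' Y' = isometrySum V W (X - X') (Y - Y') := by
  ext i j
  simp only [isometrySum, Matrix.sub_apply, Matrix.of_apply]
  noncomm_ring

theorem smul_isometrySum [Ring R] [StarRing R] [Algebra ℂ R] (V W : R) (c : ℂ)
    (X Y : Matrix (Fin 2) (Fin 2) R) :
    c • isometrySum V W X Y = isometrySum V W (c • X) (c • Y) := by
  ext i j
  simp [isometrySum]

theorem star_isometrySum [Ring R] [StarRing R] (V W : R) (X Y : Matrix (Fin 2) (Fin 2) R) :
    star (isometrySum V W X Y) = isometrySum V W (star X) (star Y) := by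
  ext i j
  simp [isometrySum, Matrix.star_apply, mul_assoc]

theorem isometrySum_zero [Ring R] [StarRing R] (V W : R) : isometrySum V W 0 0 = 0 := by
  ext i j
  simp [isometrySum]

theorem continuous_isometrySum [CStarAlgebra R] (V W : R) :
    Continuous fun P : Matrix (Fin 2) (Fin 2) R × Matrix (Fin 2) (Fin 2) R =>
      isometrySum V W P.1 P.2 := by
  refine continuous_matrix fun i j => ?_
  have h₁ := continuous_fst (X := Matrix (Fin 2) (Fin 2) R) (Y := Matrix (Fin 2) (Fin 2) R)
  have h₂ := continuous_snd (X := Matrix (Fin 2) (Fin 2) R) (Y := Matrix (Fin 2) (Fin 2) R)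
  exact ((continuous_const.mul (h₁.matrix_elem i j)).mul continuous_const).add
    ((continuous_const.mul (h₂.matrix_elem i j)).mul continuous_const)

theorem tendsto_norm_isometrySum [CStarAlgebra R] (V W : R) {ι : Type*} {l : Filter ι}
    {X Y : ι → Matrix (Fin 2) (Fin 2) R}
    (hX : Tendsto (fun t => ‖X t‖) l (𝓝 0)) (hY : Tendsto (fun t => ‖Y t‖) l (𝓝 0)) :
    Tendsto (fun t => ‖isometrySum V W (X t) (Y t)‖) l (𝓝 0) := by
  rw [← tendsto_zero_iff_norm_tendsto_zero] at *
  have h := ((continuous_isometrySum V W).tendsto (0, 0)).comp (hX.prodMk_nhds hY)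
  rw [isometrySum_zero] at h
  exact h

theorem IsAsymptoticHom.add_along_isometries {A : Type*} [NonUnitalCStarAlgebra A] [CStarAlgebra R]
    {V W : R} (hV : star V * V = 1) (hW : star W * W = 1) (hVW : V * star V + W * star W = 1)
    {φ ψ : ℝ → A → Matrix (Fin 2) (Fin 2) R} (hφ : IsAsymptoticHom φ) (hψ : IsAsymptoticHom ψ) :
    IsAsymptoticHom fun t a => isometrySum V W (φ t a) (ψ t a) := by
  obtain ⟨hφc, hφm, hφa, hφs⟩ := hφ
  obtain ⟨hψc, hψm, hψa, hψs⟩ := hψ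
  refine ⟨fun a => ?_, fun a b => ?_, fun a b c => ?_, fun a => ?_⟩
  · exact (continuous_isometrySum V W).comp_continuousOn ((hφc a).prodMk (hψc a))
  · simp only [isometrySum_mul hV hW hVW, isometrySum_sub]
    exact tendsto_norm_isometrySum V W (hφm a b) (hψm a b)
  · simp only [smul_isometrySum, isometrySum_add, isometrySum_sub]
    exact tendsto_norm_isometrySum V W (hφa a b c) (hψa a b c)
  · simp only [star_isometrySum, isometrySum_sub]
    exact tendsto_norm_isometrySum V W (hφs a) (hψs a)

end DirectSum

section UnitizedIsometry

variable {R T : Type*} [CStarAlgebra R] [CStarAlgebra T]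

theorem star_mul_self_unitized (π : R →⋆ₙₐ[ℂ] T) {V : R} (hV : star V * V = 1) :
    star (π V + (1 - π 1)) * (π V + (1 - π 1)) = 1 := by
  have h₁ : star (π V) * π V = π 1 := by rw [← map_star, ← map_mul, hV]
  have h₂ : star (π V) * π 1 = star (π V) := by rw [← map_star, ← map_mul, mul_one]
  have h₃ : π 1 * π V = π V := by rw [← map_mul, one_mul]
  have h₄ : π 1 * π 1 = π 1 := by rw [← map_mul, one_mul]
  have h₅ : star (π 1) = π 1 := by rw [← map_star, star_one]
  simp only [star_add, star_sub, star_one, h₅, add_mul, mul_add, sub_mul, mul_sub, one_mul,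
    mul_one, h₁, h₂, h₃, h₄]
  abel

theorem unitized_mul_map (π : R →⋆ₙₐ[ℂ] T) (V x : R) :
    (π V + (1 - π 1)) * π x = π (V * x) := by
  rw [add_mul, sub_mul, one_mul, ← map_mul, ← map_mul, one_mul, sub_self, add_zero]

theorem map_mul_star_unitized (π : R →⋆ₙₐ[ℂ] T) (V x : R) :
    π x * star (π V + (1 - π 1)) = π (x * star V) := by
  have h := congrArg star (unitized_mul_map π V (star x))
  simpa [-map_mul, ← map_star] using h

variable {B : TwoSidedIdeal R} {D : TwoSidedIdeal T} {π ρ : R →⋆ₙₐ[ℂ] T}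

theorem map_conj_sub_mem_right (h : ∀ b ∈ B, π b - ρ b ∈ D) (V : R) {b : R} (hb : b ∈ B) :
    π (V * b * star V) -
      (π V + (1 - π 1)) * π b * star (ρ V + (1 - ρ 1)) ∈ D := by
  have hVb : V * b ∈ B := B.mul_mem_left _ _ hb
  have e : π (V * b * star V) - (π V + (1 - π 1)) * π b * star (ρ V + (1 - ρ 1)) =
      (π (V * b * star V) - ρ (V * b * star V)) -
        (π (V * b) - ρ (V * b)) * star (ρ V + (1 - ρ 1)) := by
    rw [unitized_mul_map, sub_mul, map_mul_star_unitized]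
    abel
  rw [e]
  exact D.sub_mem (h _ (B.mul_mem_right _ _ hVb)) (D.mul_mem_right _ _ (h _ hVb))

theorem map_conj_sub_mem_left (h : ∀ b ∈ B, π b - ρ b ∈ D) (V : R) {b : R} (hb : b ∈ B) :
    π (V * b * star V) -
      (ρ V + (1 - ρ 1)) * π b * star (π V + (1 - π 1)) ∈ D := by
  have hbV : b * star V ∈ B := B.mul_mem_right _ _ hb
  have e : π (V * b * star V) - (ρ V + (1 - ρ 1)) * π b * star (π V + (1 - π 1)) =
      (π (V * (b * star V)) - ρ (V * (b * star V))) -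
        (ρ V + (1 - ρ 1)) * (π (b * star V) - ρ (b * star V)) := by
    rw [mul_assoc _ (π b), map_mul_star_unitized, mul_sub, unitized_mul_map, mul_assoc V b]
    abel
  rw [e]
  exact D.sub_mem (h _ (B.mul_mem_left _ _ hbV)) (D.mul_mem_left _ _ (h _ hbV))

theorem map_conj_eq (π : R →⋆ₙₐ[ℂ] T) (V x : R) :
    (π V + (1 - π 1)) * π x * star (π V + (1 - π 1)) = π (V * x * star V) := by
  rw [unitized_mul_map, map_mul_star_unitized]

end UnitizedIsometry

/-- Lemma on sums of trivializations (Lemma `U7`):  with `λ` defined entrywise by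
`λ^t_{jk}(a) = V₁ψ^t_{jk}(a)V₁* + V₂φ^t_{jk}(a)V₂*`, `λ` is again an asymptotic homomorphism
of the same kind, and `π_± × λ` agrees, modulo `M₂(D)`, with
`S₁(π_± × ψ)S₁* + S₂(π_± × φ)S₂*` for the indicated isometries `S₁`, `S₂`.
Here `M(B)` and `M(D)` are modelled as unital C*-algebras `MB`, `MD` containing `B`, `D` as
closed two-sided ideals. -/
theorem statement10 {A MB MD : Type*} [NonUnitalCStarAlgebra A]
    [CStarAlgebra MB] [CStarAlgebra MD]
    (B : TwoSidedIdeal MB) (hB : IsClosed (B : Set MB))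
    (D : TwoSidedIdeal MD) (hD : IsClosed (D : Set MD))
    (πp πm : MB →⋆ₙₐ[ℂ] MD) (hπ : ∀ b ∈ B, πp b - πm b ∈ D)
    (φ ψ : ℝ → A → Matrix (Fin 2) (Fin 2) MB)
    (hφ : IsAsymptoticHom φ) (hψ : IsAsymptoticHom ψ)
    (hφ_equi : Equicontinuous (fun t : Set.Ici (1 : ℝ) => φ t))
    (hψ_equi : Equicontinuous (fun t : Set.Ici (1 : ℝ) => ψ t))
    (hφ_off : ∀ t ∈ Set.Ici (1 : ℝ), ∀ a : A, φ t a 0 1 ∈ B ∧ φ t a 1 0 ∈ B)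
    (hψ_off : ∀ t ∈ Set.Ici (1 : ℝ), ∀ a : A, ψ t a 0 1 ∈ B ∧ ψ t a 1 0 ∈ B)
    (hφ_const : ∀ t ∈ Set.Ici (1 : ℝ), ∀ a : A, ∀ i j : Fin 2, φ t a i j - φ 1 a i j ∈ B)
    (hψ_const : ∀ t ∈ Set.Ici (1 : ℝ), ∀ a : A, ∀ i j : Fin 2, ψ t a i j - ψ 1 a i j ∈ B)
    (V₁ V₂ : MB) (hV₁ : star V₁ * V₁ = 1) (hV₂ : star V₂ * V₂ = 1)
    (hVV : V₁ * star V₁ + V₂ * star V₂ = 1)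
    (lam : ℝ → A → Matrix (Fin 2) (Fin 2) MB)
    (hlam : ∀ (t : ℝ) (a : A) (i j : Fin 2),
      lam t a i j = V₁ * ψ t a i j * star V₁ + V₂ * φ t a i j * star V₂)
    (S : Fin 2 → Matrix (Fin 2) (Fin 2) MD)
    (hS0 : S 0 = !![πp V₁, 0; 0, πm V₁] + !![1 - πp 1, 0; 0, 1 - πm 1])
    (hS1 : S 1 = !![πp V₂, 0; 0, πm V₂] + !![1 - πp 1, 0; 0, 1 - πm 1]) :
    -- (i)
    (IsAsymptoticHom lam ∧
      (∀ t ∈ Set.Ici (1 : ℝ), ∀ a : A, lam t a 0 1 ∈ B ∧ lam t a 1 0 ∈ B) ∧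
      (∀ t ∈ Set.Ici (1 : ℝ), ∀ a : A, ∀ i j : Fin 2, lam t a i j - lam 1 a i j ∈ B)) ∧
    -- (ii)
    (∀ i : Fin 2, star (S i) * S i = 1) ∧
    (∀ t ∈ Set.Ici (1 : ℝ), ∀ a : A, ∀ i j : Fin 2,
      ((!![πp (lam t a 0 0), πp (lam t a 0 1); πp (lam t a 1 0), πm (lam t a 1 1)]
        - S 0 * !![πp (ψ t a 0 0), πp (ψ t a 0 1); πp (ψ t a 1 0), πm (ψ t a 1 1)] * star (S 0)
        - S 1 * !![πp (φ t a 0 0), πp (φ t a 0 1); πp (φ t a 1 0), πm (φ t a 1 1)] * star (S 1))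
          i j) ∈ D) := by
  have hlam' : lam = fun t a => isometrySum V₁ V₂ (ψ t a) (φ t a) := by
    funext t a
    ext i j
    rw [hlam]
    rfl
  have hdiag (V : MB) : !![πp V, 0; 0, πm V] + !![1 - πp 1, 0; 0, 1 - πm 1] =
      !![πp V + (1 - πp 1), 0; 0, πm V + (1 - πm 1)] := by
    ext i j
    fin_cases i <;> fin_cases j <;> simp
  have hstar (x y : MD) : star !![x, 0; 0, y] = !![star x, 0; 0, star y] := by
    ext i j
    fin_cases i <;> fin_cases j <;> simp [Matrix.star_apply]
  have hisom (V : MB) (hV : star V * V = 1) :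
      star !![πp V + (1 - πp 1), 0; 0, πm V + (1 - πm 1)] *
        !![πp V + (1 - πp 1), 0; 0, πm V + (1 - πm 1)] = 1 := by
    rw [hstar, Matrix.mul_fin_two, Matrix.one_fin_two, star_mul_self_unitized πp hV,
      star_mul_self_unitized πm hV]
    simp
  have hconj {x y : MB} (hx : x ∈ B) (hy : y ∈ B) : V₁ * x * star V₁ + V₂ * y * star V₂ ∈ B :=
    B.add_mem (B.mul_mem_right _ _ (B.mul_mem_left _ _ hx))
      (B.mul_mem_right _ _ (B.mul_mem_left _ _ hy))
  rw [hdiag] at hS0 hS1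
  refine ⟨⟨?_, fun t ht a => ?_, fun t ht a i j => ?_⟩, fun i => ?_, fun t ht a i j => ?_⟩
  · rw [hlam']
    exact hψ.add_along_isometries hV₁ hV₂ hVV hφ
  · rw [hlam, hlam]
    exact ⟨hconj (hψ_off t ht a).1 (hφ_off t ht a).1, hconj (hψ_off t ht a).2 (hφ_off t ht a).2⟩
  · have e := hconj (hψ_const t ht a i j) (hφ_const t ht a i j)
    rw [hlam, hlam]
    convert e using 1
    noncomm_ring
  · fin_cases i
    · exact hS0 ▸ hisom V₁ hV₁
    · exact hS1 ▸ hisom V₂ hV₂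
  · rw [hS0, hS1, hstar, hstar]
    simp only [Matrix.mul_fin_two, zero_mul, mul_zero, add_zero, zero_add, hlam, map_add πp,
      map_add πm, map_conj_eq]
    fin_cases i <;> fin_cases j <;>
      simp only [Fin.zero_eta, Fin.mk_one, Matrix.sub_apply, Matrix.of_apply, Matrix.cons_val',
        Matrix.cons_val_zero, Matrix.cons_val_one, Matrix.cons_val_fin_one]
    · simp [D.zero_mem]
    · rw [sub_sub, add_sub_add_comm]
      exact D.add_mem (map_conj_sub_mem_right hπ V₁ (hψ_off t ht a).1)
        (map_conj_sub_mem_right hπ V₂ (hφ_off t ht a).1)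
    · rw [sub_sub, add_sub_add_comm]
      exact D.add_mem (map_conj_sub_mem_left hπ V₁ (hψ_off t ht a).2)
        (map_conj_sub_mem_left hπ V₂ (hφ_off t ht a).2)
    · simp [D.zero_mem]
end
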